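/- Let q : ℝ × ℝ → ℂ be smooth. For each λ ∈ ℂ define the 2×2 complex matrices U(λ,x,t) with rows (iλ, i·q(x,t)) and (i·conj(q(x,t)), −iλ), and V(λ,x,t) = −2λ·U(λ,x,t) + M(x,t), where M(x,t) has rows (i·q(x,t)·conj(q(x,t)), −∂ₓq(x,t)) and (conj(∂ₓq(x,t)), −i·q(x,t)·conj(q(x,t))). Then q satisfies the self-focusing NLS equation i·∂ₜq + ∂ₓ²q + 2·q²·conj(q) = 0 on all of ℝ² if and only if the zero-curvature equation ∂ₜU(λ,x,t) − ∂ₓV(λ,x,t) + U(λ,x,t)·V(λ,x,t) − V(λ,x,t)·U(λ,x,t) = 0 holds for all λ ∈ ℂ and all (x,t) ∈ ℝ². -/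

import Mathlib

open Complex ComplexConjugate

/-- Partial derivative in the first (space) variable. -/
noncomputable def px (q : ℝ × ℝ → ℂ) (x t : ℝ) : ℂ := deriv (fun y => q (y, t)) x

/-- Partial derivative in the second (time) variable. -/
noncomputable def pt (q : ℝ × ℝ → ℂ) (x t : ℝ) : ℂ := deriv (fun s => q (x, s)) t

/-- Second partial derivative in the space variable. -/
noncomputable def pxx (q : ℝ × ℝ → ℂ) (x t : ℝ) : ℂ := deriv (fun y => px q y t) x

/-- The matrix `U(λ,x,t)` of the zero-curvature representation. -/
noncomputable def Umat (q : ℝ × ℝ → ℂ) (lam : ℂ) (x t : ℝ) : Matrix (Fin 2) (Fin 2) ℂ :=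
  !![Complex.I * lam, Complex.I * q (x, t);
     Complex.I * conj (q (x, t)), -(Complex.I * lam)]

/-- The matrix `V(λ,x,t) = -2λ U(λ,x,t) + M(x,t)` of the zero-curvature representation. -/
noncomputable def Vmat (q : ℝ × ℝ → ℂ) (lam : ℂ) (x t : ℝ) : Matrix (Fin 2) (Fin 2) ℂ :=
  (-(2 * lam)) • Umat q lam x t +
  !![Complex.I * q (x, t) * conj (q (x, t)), -(px q x t);
     conj (px q x t), -(Complex.I * q (x, t) * conj (q (x, t)))]

/-- Entrywise derivative of a matrix-valued function of a real variable. -/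
noncomputable def matDeriv (f : ℝ → Matrix (Fin 2) (Fin 2) ℂ) (x : ℝ) :
    Matrix (Fin 2) (Fin 2) ℂ :=
  Matrix.of fun i j => deriv (fun s => f s i j) x

theorem sfnls_iff_zero_curvature (q : ℝ × ℝ → ℂ) (hq : ContDiff ℝ (⊤ : ℕ∞) q) :
    (∀ x t : ℝ,
      Complex.I * pt q x t + pxx q x t + 2 * (q (x, t)) ^ 2 * conj (q (x, t)) = 0) ↔
    (∀ (lam : ℂ) (x t : ℝ),
      matDeriv (fun s => Umat q lam x s) t - matDeriv (fun y => Vmat q lam y t) x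
        + Umat q lam x t * Vmat q lam x t - Vmat q lam x t * Umat q lam x t = 0) := by
  have hqx : ∀ x t, HasDerivAt (fun y => q (y, t)) (px q x t) x := by
    intro x t
    have h : ContDiff ℝ (⊤ : ℕ∞) (fun y : ℝ => q (y, t)) := by fun_prop
    exact ((h.differentiable (by simp)) x).hasDerivAt
  have hqt : ∀ x t, HasDerivAt (fun s => q (x, s)) (pt q x t) t := by
    intro x t
    have h : ContDiff ℝ (⊤ : ℕ∞) (fun s : ℝ => q (x, s)) := by fun_prop
    exact ((h.differentiable (by simp)) t).hasDerivAt
  have hqxx : ∀ x t, HasDerivAt (fun y => px q y t) (pxx q x t) x := by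
    intro x t
    have h : ContDiff ℝ (⊤ : ℕ∞) (fun y : ℝ => q (y, t)) := by fun_prop
    have h2 : ContDiff ℝ (⊤ : ℕ∞) (deriv (fun y : ℝ => q (y, t))) :=
      (contDiff_infty_iff_deriv.1 h).2
    exact ((h2.differentiable (by simp)) x).hasDerivAt
  have key : ∀ (lam : ℂ) (x t : ℝ),
      matDeriv (fun s => Umat q lam x s) t - matDeriv (fun y => Vmat q lam y t) x
        + Umat q lam x t * Vmat q lam x t - Vmat q lam x t * Umat q lam x t
      = !![0, I * pt q x t + pxx q x t + 2 * (q (x, t)) ^ 2 * conj (q (x, t));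
          -conj (I * pt q x t + pxx q x t + 2 * (q (x, t)) ^ 2 * conj (q (x, t))), 0] := by
    intro lam x t
    have a := hqx x t
    have b := hqt x t
    have c := hqxx x t
    have haconj : HasDerivAt (fun y => conj (q (y, t))) (conj (px q x t)) x := a.star
    have hbconj : HasDerivAt (fun s => conj (q (x, s))) (conj (pt q x t)) t := b.star
    have hcconj : HasDerivAt (fun y => conj (px q y t)) (conj (pxx q x t)) x := c.star
    have u : matDeriv (fun s => Umat q lam x s) t
        = !![0, I * pt q x t; I * conj (pt q x t), 0] := by
      ext i j
      fin_cases i <;> fin_cases j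
      · simp [matDeriv, Umat]
      · simpa [matDeriv, Umat] using (b.const_mul I).deriv
      · simpa [matDeriv, Umat] using (hbconj.const_mul I).deriv
      · simp [matDeriv, Umat]
    have m := (a.const_mul I).mul haconj
    have v : matDeriv (fun y => Vmat q lam y t) x
        = !![I * px q x t * conj (q (x, t)) + I * q (x, t) * conj (px q x t),
             -(2 * lam) * (I * px q x t) + -pxx q x t;
             -(2 * lam) * (I * conj (px q x t)) + conj (pxx q x t),
             -(I * px q x t * conj (q (x, t)) + I * q (x, t) * conj (px q x t))] := by
      ext i j
      fin_cases i <;> fin_cases j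
      · exact (m.const_add (-(2 * lam) * (I * lam))).deriv
      · exact (((a.const_mul I).const_mul (-(2 * lam))).add c.neg).deriv
      · exact (((haconj.const_mul I).const_mul (-(2 * lam))).add hcconj).deriv
      · exact (m.neg.const_add (-(2 * lam) * -(I * lam))).deriv
    rw [u, v]
    have hI : I * I = -1 := I_mul_I
    have h2 : conj (2 : ℂ) = 2 := Complex.conj_ofNat 2
    ext i j
    fin_cases i <;> fin_cases j <;>
      simp [Umat, Vmat] <;>
      clear * - hI h2 <;> grind
  constructor
  · intro h lam x t
    rw [key, h x t]
    ext i j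
    fin_cases i <;> fin_cases j <;> simp
  · intro h x t
    have h1 := h 0 x t
    rw [key] at h1
    simpa using congrFun (congrFun h1 0) 1
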